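/- arXiv:1711.04724 — 3 statements merged into one kernel-verified Lean document; each statement's English description precedes it below -/
import Mathlib

section
/- Let A be a standard C*-algebra on a Hilbert space H, let E and F be inner product A-modules, and let T, S : E → F be two nonzero A-linear mappings such that for all x, y ∈ E, ⟨x, y⟩ = 0 implies ⟨T(x), S(y)⟩ = 0. Then there exists γ ∈ ℂ such that ⟨T(x), S(y)⟩ = γ·⟨x, y⟩ for all x, y ∈ E. -/
/-- An inner product module over a C*-algebra `A`: a (left) `A`-module `E` together with an
`A`-valued inner product which is `ℂ`-linear and `A`-linear in the first variable, conjugate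
symmetric, and positive definite. -/
structure CStarInnerProductModule (A E : Type*) [NonUnitalCStarAlgebra A]
    [PartialOrder A] [StarOrderedRing A]
    [AddCommGroup E] [Module ℂ E] [SMul A E] where
  inner : E → E → A
  add_left : ∀ x y z : E, inner (x + y) z = inner x z + inner y z
  smulC_left : ∀ (c : ℂ) (x y : E), inner (c • x) y = c • inner x y
  smulA_left : ∀ (a : A) (x y : E), inner (a • x) y = a * inner x y
  star_inner : ∀ x y : E, star (inner x y) = inner y x
  inner_self_nonneg : ∀ x : E, 0 ≤ inner x x
  inner_self_eq_zero : ∀ x : E, inner x x = 0 ↔ x = 0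
  smul_add : ∀ (a : A) (x y : E), a • (x + y) = a • x + a • y
  add_smul : ∀ (a b : A) (x : E), (a + b) • x = a • x + b • x
  mul_smul : ∀ (a b : A) (x : E), (a * b) • x = a • (b • x)
  smul_assoc : ∀ (c : ℂ) (a : A) (x : E), (c • a) • x = c • (a • x)

open scoped InnerProductSpace

/-- If a sesquilinear form `q` vanishes wherever a reflexive form `p` vanishes, and isotropic vectors
of `p` lie in its kernel, then `q` is a scalar multiple of `p`. -/
theorem LinearMap.exists_eq_smul_of_orthogonality_preserving {V : Type*} [AddCommGroup V]
    [Module ℂ V] (p q : V →ₗ[ℂ] V →ₗ⋆[ℂ] ℂ) (hrefl : ∀ x y, p x y = 0 → p y x = 0)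
    (hp : ∀ y, p y y = 0 → ∀ x, p x y = 0) (hpq : ∀ x y, p x y = 0 → q x y = 0) :
    ∃ γ : ℂ, ∀ x y, q x y = γ * p x y := by
  have hright : ∀ x y, q x y * p y y = p x y * q y y := by
    intro x y
    have h := hpq (p y y • x - p x y • y) y (by simp; ring)
    simp only [map_sub, map_smul, LinearMap.sub_apply, LinearMap.smul_apply, smul_eq_mul] at h
    linear_combination h
  have hleft : ∀ x y, q x y * p x x = p x y * q x x := by
    intro x y
    have h := hpq x (star (p x x) • y - star (p x y) • x) (by simp; ring)
    simp only [map_sub, map_smulₛₗ, smul_eq_mul, starRingEnd_apply, star_star] at h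
    linear_combination h
  by_cases hu : ∃ u, p u u ≠ 0
  · obtain ⟨u, hu⟩ := hu
    obtain ⟨γ, hγ⟩ : ∃ γ, q u u = γ * p u u := ⟨q u u / p u u, by field_simp⟩
    have hdiag_of_ne : ∀ x, p x u ≠ 0 → q x x = γ * p x x := by
      intro x hx
      have h : q x u = γ * p x u := mul_right_cancel₀ hu (by rw [hright, hγ]; ring)
      exact mul_left_cancel₀ hx (by rw [← hleft, h]; ring)
    have hdiag : ∀ x, q x x = γ * p x x := by
      intro x
      by_cases hx : p x u = 0
      · have hx' := hrefl _ _ hx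
        have h := hdiag_of_ne (x + u) (by simpa [hx] using hu)
        simp only [map_add, LinearMap.add_apply, hx, hx', hpq _ _ hx, hpq _ _ hx'] at h
        linear_combination h - hγ
      · exact hdiag_of_ne x hx
    refine ⟨γ, fun x y => ?_⟩
    by_cases hy : p y y = 0
    · rw [hpq x y (hp y hy x), hp y hy x, mul_zero]
    · exact mul_right_cancel₀ hy (by rw [hright, hdiag]; ring)
  · push Not at hu
    exact ⟨0, fun x y => by rw [hpq x y (hp y (hu y) x), zero_mul]⟩

theorem InnerProductSpace.isCompactOperator_rankOne {H : Type*} [NormedAddCommGroup H]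
    [InnerProductSpace ℂ H] (x y : H) :
    IsCompactOperator (InnerProductSpace.rankOne ℂ x y) :=
  (isCompactOperator_of_locallyCompactSpace_dom (innerSL ℂ y)).clm_comp
    (ContinuousLinearMap.toSpanSingleton ℂ x)

namespace CStarInnerProductModule

section

variable {A E : Type*} [NonUnitalCStarAlgebra A] [PartialOrder A] [StarOrderedRing A]
  [AddCommGroup E] [Module ℂ E] [SMul A E] (M : CStarInnerProductModule A E)

theorem add_right (x y z : E) : M.inner x (y + z) = M.inner x y + M.inner x z := by
  rw [← M.star_inner, M.add_left, star_add, M.star_inner, M.star_inner]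

theorem smulC_right (c : ℂ) (x y : E) : M.inner x (c • y) = star c • M.inner x y := by
  rw [← M.star_inner, M.smulC_left, star_smul, M.star_inner]

theorem inner_smulA_smulA (a b : A) (x y : E) :
    M.inner (a • x) (b • y) = a * M.inner x y * star b := by
  rw [M.smulA_left, ← M.star_inner (b • y) x, M.smulA_left, star_mul, M.star_inner, mul_assoc]

theorem zero_left (y : E) : M.inner 0 y = 0 := by
  simpa using M.smulC_left 0 0 y

variable {H : Type*} [NormedAddCommGroup H] [InnerProductSpace ℂ H] [CompleteSpace H]

/-- The vector functional of `ξ` applied to the `A`-valued form `(x, y) ↦ ⟪T x, S y⟫`. -/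
noncomputable def vectorForm {V : Type*} [AddCommGroup V] [Module ℂ V]
    (π : A →⋆ₙₐ[ℂ] (H →L[ℂ] H)) (ξ : H) (T S : V →ₗ[ℂ] E) : V →ₗ[ℂ] V →ₗ⋆[ℂ] ℂ :=
  LinearMap.mk₂'ₛₗ (RingHom.id ℂ) (starRingEnd ℂ)
    (fun x y => ⟪ξ, π (M.inner (T x) (S y)) ξ⟫_ℂ)
    (fun x y z => by simp [M.add_left])
    (fun c x y => by simp [M.smulC_left])
    (fun x y z => by simp [M.add_right])
    (fun c x y => by simp [M.smulC_right])

@[simp] theorem vectorForm_apply {V : Type*} [AddCommGroup V] [Module ℂ V]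
    (π : A →⋆ₙₐ[ℂ] (H →L[ℂ] H)) (ξ : H) (T S : V →ₗ[ℂ] E) (x y : V) :
    M.vectorForm π ξ T S x y = ⟪ξ, π (M.inner (T x) (S y)) ξ⟫_ℂ := rfl

/-- Multiplying by elements representing rank-one operators compresses the inner product to a
matrix coefficient. -/
theorem map_inner_smul_smul_of_rankOne (π : A →⋆ₙₐ[ℂ] (H →L[ℂ] H)) {a b : A} {ζ ξ η : H}
    (ha : π a = InnerProductSpace.rankOne ℂ ζ ξ) (hb : π b = InnerProductSpace.rankOne ℂ ζ η)
    (x y : E) :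
    π (M.inner (a • x) (b • y)) =
      ⟪ξ, π (M.inner x y) η⟫_ℂ • InnerProductSpace.rankOne ℂ ζ ζ := by
  rw [M.inner_smulA_smulA, map_mul, map_mul, map_star, ha, hb,
    ContinuousLinearMap.star_eq_adjoint, InnerProductSpace.adjoint_rankOne]
  ext v
  simp [smul_smul, mul_comm]

end

end CStarInnerProductModule

/-- **Theorem 3.5**: let `A` be a standard C*-algebra on a Hilbert space `H` (realized via an
isometric star homomorphism `π : A → B(H)` whose range contains all compact operators), let
`E, F` be inner product `A`-modules, and let `T, S : E → F` be two nonzero `A`-linear maps such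
that `⟪x, y⟫ = 0` implies `⟪T x, S y⟫ = 0`.  Then there is `γ ∈ ℂ` with
`⟪T x, S y⟫ = γ • ⟪x, y⟫` for all `x, y ∈ E`. -/
theorem standard_orthogonality_preserving_pair
    {H : Type*} [NormedAddCommGroup H] [InnerProductSpace ℂ H] [CompleteSpace H]
    {A E F : Type*} [NonUnitalCStarAlgebra A] [PartialOrder A] [StarOrderedRing A]
    (π : A →⋆ₙₐ[ℂ] (H →L[ℂ] H)) (hπ : Isometry π)
    (hcpt : ∀ f : H →L[ℂ] H, IsCompactOperator (⇑f) → f ∈ Set.range π)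
    [AddCommGroup E] [Module ℂ E] [SMul A E]
    [AddCommGroup F] [Module ℂ F] [SMul A F]
    (ME : CStarInnerProductModule A E) (MF : CStarInnerProductModule A F)
    (T S : E → F) (hT : T ≠ 0) (hS : S ≠ 0)
    (hTadd : ∀ x y : E, T (x + y) = T x + T y)
    (hTsmulC : ∀ (c : ℂ) (x : E), T (c • x) = c • T x)
    (hTsmulA : ∀ (a : A) (x : E), T (a • x) = a • T x)
    (hSadd : ∀ x y : E, S (x + y) = S x + S y)
    (hSsmulC : ∀ (c : ℂ) (x : E), S (c • x) = c • S x)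
    (hSsmulA : ∀ (a : A) (x : E), S (a • x) = a • S x)
    (hTS : ∀ x y : E, ME.inner x y = 0 → MF.inner (T x) (S y) = 0) :
    ∃ γ : ℂ, ∀ x y : E, MF.inner (T x) (S y) = γ • ME.inner x y := by
  rcases subsingleton_or_nontrivial H with hH | hH
  · exact ⟨0, fun x y => hπ.injective (Subsingleton.elim _ _)⟩
  obtain ⟨ζ, hζ⟩ := exists_norm_eq (E := H) (zero_le_one' ℝ)
  have hζ0 : ζ ≠ 0 := by rintro rfl; simp at hζ
  have hR : InnerProductSpace.rankOne ℂ ζ ζ ≠ 0 :=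
    InnerProductSpace.rankOne_ne_zero hζ0 hζ0
  choose a ha using fun ξ : H => hcpt _ (InnerProductSpace.isCompactOperator_rankOne ζ ξ)
  let T' : E →ₗ[ℂ] F := ⟨⟨T, hTadd⟩, hTsmulC⟩
  let S' : E →ₗ[ℂ] F := ⟨⟨S, hSadd⟩, hSsmulC⟩
  let p := ME.vectorForm π ζ LinearMap.id LinearMap.id
  let q := MF.vectorForm π ζ T' S'
  have hpe : ∀ x y, π (ME.inner (a ζ • x) (a ζ • y)) =
      p x y • InnerProductSpace.rankOne ℂ ζ ζ := fun x y =>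
    ME.map_inner_smul_smul_of_rankOne π (ha ζ) (ha ζ) x y
  have hqe : ∀ x y, π (MF.inner (T (a ζ • x)) (S (a ζ • y))) =
      q x y • InnerProductSpace.rankOne ℂ ζ ζ := fun x y => by
    rw [hTsmulA, hSsmulA]
    exact MF.map_inner_smul_smul_of_rankOne π (ha ζ) (ha ζ) (T x) (S y)
  have hpzero : ∀ x y, ME.inner (a ζ • x) (a ζ • y) = 0 ↔ p x y = 0 := fun x y => by
    rw [← map_eq_zero_iff π hπ.injective, hpe, smul_eq_zero_iff_left hR]
  have hrefl : ∀ x y, p x y = 0 → p y x = 0 := fun x y h => by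
    rw [← hpzero] at h ⊢
    rw [← ME.star_inner, h, star_zero]
  obtain ⟨γ, hγ⟩ := LinearMap.exists_eq_smul_of_orthogonality_preserving p q hrefl
    (fun y hy x => hrefl _ _ <| by
      rw [← hpzero] at hy ⊢
      rw [(ME.inner_self_eq_zero _).1 hy, ME.zero_left])
    (fun x y h => by
      have h0 := hTS _ _ ((hpzero x y).2 h)
      rwa [← map_eq_zero_iff π hπ.injective, hqe, smul_eq_zero_iff_left hR] at h0)
  refine ⟨γ, fun x y => hπ.injective ?_⟩
  rw [map_smul]
  refine ContinuousLinearMap.ext fun η => ext_inner_left ℂ fun ξ => ?_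
  have h := hγ (a ξ • x) (a η • y)
  have hp : p (a ξ • x) (a η • y) = ⟪ξ, π (ME.inner x y) η⟫_ℂ := by
    simp only [p, CStarInnerProductModule.vectorForm_apply, LinearMap.id_apply,
      ME.map_inner_smul_smul_of_rankOne π (ha ξ) (ha η)]
    simp [hζ]
  have hq : q (a ξ • x) (a η • y) = ⟪ξ, π (MF.inner (T x) (S y)) η⟫_ℂ := by
    change ⟪ζ, π (MF.inner (T (a ξ • x)) (S (a η • y))) ζ⟫_ℂ = _
    rw [hTsmulA, hSsmulA, MF.map_inner_smul_smul_of_rankOne π (ha ξ) (ha η)]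
    simp [hζ]
  rw [hp, hq] at h
  simpa [inner_smul_right] using h
end

section
/- Let A be a standard C*-algebra on a Hilbert space H, let E and F be inner product A-modules, and let T, S : E → F be two nonzero local mappings. The following statements are mutually equivalent: (i) for all x, y ∈ E, ⟨x, y⟩ = 0 implies ⟨T(x), S(y)⟩ = 0; (ii) there exists γ ∈ ℂ such that ⟨T(x), S(x)⟩ = γ·⟨x, x⟩ for all x ∈ E; (iii) there exists γ ∈ ℂ such that ⟨T(x), S(y)⟩ = γ·⟨x, y⟩ for all x, y ∈ E. Under these conditions the mappings T and S are A-linear. -/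
namespace LinearMap

/-- Two sesquilinear forms are proportional if the zero set of the first lies in that of the
second. -/
theorem exists_eq_smul_of_forall_eq_zero {K V W : Type*} [Field K] [StarRing K]
    [AddCommGroup V] [Module K V] [AddCommGroup W] [Module K W]
    (B C : V →ₗ[K] W →ₗ⋆[K] K) (h : ∀ x y, B x y = 0 → C x y = 0) :
    ∃ γ : K, ∀ x y, C x y = γ * B x y := by
  by_cases hB : ∀ x y, B x y = 0
  · exact ⟨0, fun x y => by simp [hB x y, h x y (hB x y)]⟩
  push Not at hB
  obtain ⟨x₀, y₀, hb⟩ := hB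
  set b := B x₀ y₀ with hb_def
  set γ := C x₀ y₀ / b with hγ
  have h₀ : C x₀ y₀ = γ * b := by rw [hγ]; field_simp
  have hleft : ∀ x, C x y₀ = γ * B x y₀ := fun x => by
    have := h (x - (B x y₀ / b) • x₀) y₀ (by simp [← hb_def, hb])
    simp only [map_sub, map_smul, sub_apply, smul_apply, smul_eq_mul, h₀, sub_eq_zero] at this
    rw [this]; field_simp
  have hright : ∀ y, C x₀ y = γ * B x₀ y := fun y => by
    have := h x₀ (y - star (B x₀ y / b) • y₀) (by
      simp only [map_sub, map_smulₛₗ, starRingEnd_apply, star_star, smul_eq_mul, ← hb_def]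
      field_simp
      ring)
    simp only [map_sub, map_smulₛₗ, starRingEnd_apply, star_star, smul_eq_mul, h₀,
      sub_eq_zero] at this
    rw [this]; field_simp
  refine ⟨γ, fun x y => ?_⟩
  set t := star (1 - B x₀ y / b) with ht
  have hst : star t = 1 - B x₀ y / b := by rw [ht, star_star]
  have h₁ : B x₀ (y + t • y₀) = b := by
    simp only [map_add, map_smulₛₗ, starRingEnd_apply, hst, smul_eq_mul, ← hb_def]
    field_simp
    ring
  have h₂ := h (x - (B x (y + t • y₀) / b) • x₀) (y + t • y₀) (by
    rw [map_sub, map_smul, sub_apply, smul_apply, h₁, smul_eq_mul, div_mul_cancel₀ _ hb, sub_self])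
  rw [map_sub, map_smul, sub_apply, smul_apply, hright, h₁, smul_eq_mul, sub_eq_zero] at h₂
  have h₃ : C x (y + t • y₀) = γ * B x (y + t • y₀) := by rw [h₂]; field_simp
  simp only [map_add, map_smulₛₗ, smul_eq_mul, hleft] at h₃
  linear_combination h₃

/-- A complex sesquilinear map that vanishes on the diagonal is zero. -/
theorem eq_zero_of_forall_apply_self_eq_zero {V W : Type*} [AddCommGroup V] [Module ℂ V]
    [AddCommGroup W] [Module ℂ W] (D : V →ₗ[ℂ] V →ₗ⋆[ℂ] W) (h : ∀ x, D x x = 0) : D = 0 := by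
  ext x y
  have h₁ : D x y + D y x = 0 := by simpa [h] using h (x + y)
  have h₂ : -(Complex.I • D x y) + Complex.I • D y x = 0 := by
    simpa [h] using h (x + Complex.I • y)
  have h₃ : D y x = D x y := by
    rw [neg_add_eq_zero] at h₂
    exact (smul_right_injective W Complex.I_ne_zero h₂).symm
  rw [h₃, ← two_smul ℂ, smul_eq_zero] at h₁
  simpa using h₁

end LinearMap

namespace InnerProductSpace

theorem isCompactOperator_rankOne_s8 {H : Type*} [NormedAddCommGroup H] [InnerProductSpace ℂ H]
    (x y : H) : IsCompactOperator (rankOne ℂ x y) :=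
  ((isCompactOperator_id (E := ℂ)).clm_comp (.toSpanSingleton ℂ x)).comp_clm (innerSL ℂ y)

end InnerProductSpace

section MatrixCoefficient

open InnerProductSpace

variable {A H : Type*} [NonUnitalCStarAlgebra A] [NormedAddCommGroup H] [InnerProductSpace ℂ H]
  [CompleteSpace H] (π : A →⋆ₙₐ[ℂ] (H →L[ℂ] H))

theorem NonUnitalStarAlgHom.map_rankOne_mul_mul_star (r : H → H → A)
    (hr : ∀ ξ η, π (r ξ η) = rankOne ℂ ξ η) (e ξ η : H) (a : A) :
    π (r e ξ * a * star (r e η)) = ⟪ξ, π a η⟫_ℂ • rankOne ℂ e e := by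
  rw [map_mul, map_mul, map_star, hr, hr, ContinuousLinearMap.star_eq_adjoint, adjoint_rankOne]
  ext ζ
  simp [smul_smul, mul_comm]

/-- The matrix coefficient `a ↦ ⟪ξ, π a η⟫` as a linear functional. -/
noncomputable def NonUnitalStarAlgHom.matrixCoeff (ξ η : H) : A →ₗ[ℂ] ℂ where
  toFun a := ⟪ξ, π a η⟫_ℂ
  map_add' a b := by simp
  map_smul' c a := by simp

end MatrixCoefficient

namespace CStarInnerProductModule

variable {A E F : Type*} [NonUnitalCStarAlgebra A] [PartialOrder A] [StarOrderedRing A]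
  [AddCommGroup E] [Module ℂ E] [SMul A E] [AddCommGroup F] [Module ℂ F] [SMul A F]
  (M : CStarInnerProductModule A E)

/-- The inner product as a sesquilinear map over `ℂ`. -/
def innerₛₗ : E →ₗ[ℂ] E →ₗ⋆[ℂ] A :=
  LinearMap.mk₂'ₛₗ (RingHom.id ℂ) (starRingEnd ℂ) M.inner M.add_left M.smulC_left
    (fun x y z => by rw [← M.star_inner, M.add_left, star_add, M.star_inner, M.star_inner])
    (fun c x y => by rw [← M.star_inner, M.smulC_left, star_smul, M.star_inner]; rfl)

@[simp]
theorem innerₛₗ_apply (x y : E) : M.innerₛₗ x y = M.inner x y := rfl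

theorem inner_smulA_right (a : A) (x y : E) : M.inner x (a • y) = M.inner x y * star a := by
  rw [← M.star_inner, M.smulA_left, star_mul, M.star_inner]

theorem ext_inner_right {x y : E} (h : ∀ z, M.inner x z = M.inner y z) : x = y := by
  rw [← sub_eq_zero, ← M.inner_self_eq_zero, ← M.innerₛₗ_apply, LinearMap.map_sub₂,
    innerₛₗ_apply, innerₛₗ_apply, h, sub_self]

/-- The action of `a : A` as a `ℂ`-linear map. -/
def smulₗ (a : A) : E →ₗ[ℂ] E where
  toFun x := a • x
  map_add' := M.smul_add a
  map_smul' c x := M.ext_inner_right fun z => by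
    simp only [M.smulA_left, M.smulC_left, mul_smul_comm, RingHom.id_apply]

theorem smulA_sub (M : CStarInnerProductModule A E) (a : A) (x y : E) :
    a • (x - y) = a • x - a • y := (M.smulₗ a).map_sub x y

theorem sub_smulA (M : CStarInnerProductModule A E) (a b : A) (x : E) :
    (a - b) • x = a • x - b • x := by
  rw [eq_sub_iff_add_eq, ← M.add_smul, sub_add_cancel]

theorem zero_smulA (M : CStarInnerProductModule A E) (x : E) : (0 : A) • x = 0 := by
  rw [← sub_self (0 : A), M.sub_smulA, sub_self]

theorem eq_of_forall_smul_eq (M : CStarInnerProductModule A E) {x y : E}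
    (h : ∀ a : A, a • x = a • y) : x = y := by
  rw [← sub_eq_zero, ← M.inner_self_eq_zero, ← CStarRing.star_mul_self_eq_zero_iff,
    M.star_inner, ← M.smulA_left, M.smulA_sub, h, sub_self]
  exact M.innerₛₗ.map_zero₂ _

/-- A local map commutes with the action of idempotents. -/
theorem map_smul_of_isIdempotentElem (M : CStarInnerProductModule A E)
    (N : CStarInnerProductModule A F) (T : E →ₗ[ℂ] F)
    (hT : ∀ (a : A) (x : E), a • x = 0 → a • T x = 0) {p : A} (hp : IsIdempotentElem p) (x : E) :
    T (p • x) = p • T x := by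
  have hpp : p • T (p • x) = p • T x := by
    have := hT p (x - p • x) (by rw [M.smulA_sub, ← M.mul_smul, hp.eq, sub_self])
    rw [map_sub, N.smulA_sub, sub_eq_zero] at this
    exact this.symm
  rw [← hpp]
  refine N.eq_of_forall_smul_eq fun c => ?_
  have := hT (c - c * p) (p • x) (by
    rw [M.sub_smulA, ← M.mul_smul, ← M.mul_smul, mul_assoc, hp.eq, sub_self])
  rwa [N.sub_smulA, N.mul_smul, sub_eq_zero] at this

section Standard

open InnerProductSpace

variable {H : Type*} [NormedAddCommGroup H] [InnerProductSpace ℂ H] [CompleteSpace H]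
  (π : A →⋆ₙₐ[ℂ] (H →L[ℂ] H)) (r : H → H → A)

/-- A local map commutes with the action of rank-one operators. -/
theorem map_smul_of_rankOne (hπ : Function.Injective π) (hr : ∀ ξ η, π (r ξ η) = rankOne ℂ ξ η)
    (M : CStarInnerProductModule A E) (N : CStarInnerProductModule A F) (T : E →ₗ[ℂ] F)
    (hT : ∀ (a : A) (x : E), a • x = 0 → a • T x = 0) (ξ η : H) (x : E) :
    T (r ξ η • x) = r ξ η • T x := by
  have key : ∀ ξ η : H, ⟪η, ξ⟫_ℂ ≠ 0 → T (r ξ η • x) = r ξ η • T x := by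
    intro ξ η h
    have hp : IsIdempotentElem ((⟪η, ξ⟫_ℂ)⁻¹ • r ξ η) := hπ <| by
      ext ζ
      simp only [map_smul, map_mul, hr, mul_apply_eq_comp, smul_apply, rankOne_apply, smul_smul]
      field_simp
    have := map_smul_of_isIdempotentElem M N T hT hp x
    rw [M.smul_assoc, N.smul_assoc, map_smul] at this
    exact smul_right_injective F (inv_ne_zero h) this
  by_cases h : ⟪η, ξ⟫_ℂ = 0
  · by_cases hη : η = 0
    · have : r ξ η = 0 := hπ (by simp [hr, hη])
      rw [this, M.zero_smulA, N.zero_smulA, map_zero]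
    · have hηη : ⟪η, η⟫_ℂ ≠ 0 := inner_self_ne_zero.2 hη
      have : r ξ η = r (ξ + η) η - r η η := hπ (by simp [hr])
      rw [this, M.sub_smulA, N.sub_smulA, map_sub, key _ _ hηη,
        key (ξ + η) η (by rwa [inner_add_right, h, zero_add])]
  · exact key ξ η h

/-- Rank-one operators separate the points of an inner product module. -/
theorem eq_of_forall_rankOne_smul_eq (hπ : Function.Injective π)
    (hr : ∀ ξ η, π (r ξ η) = rankOne ℂ ξ η) (M : CStarInnerProductModule A E) {x y : E}
    (h : ∀ ξ η, r ξ η • x = r ξ η • y) : x = y := by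
  refine M.ext_inner_right fun z => hπ <| ContinuousLinearMap.ext fun ζ => ?_
  refine ext_inner_left ℂ fun η => ?_
  have h₁ : π (r η η * M.inner x z) ζ = π (r η η * M.inner y z) ζ := by
    rw [← M.smulA_left, ← M.smulA_left, h]
  by_cases hη : η = 0
  · simp [hη]
  · simpa [hr, hη] using h₁

/-- Local maps between inner product modules over a standard C*-algebra are `A`-linear. -/
theorem map_smul_of_local (hπ : Function.Injective π) (hr : ∀ ξ η, π (r ξ η) = rankOne ℂ ξ η)
    (M : CStarInnerProductModule A E) (N : CStarInnerProductModule A F) (T : E →ₗ[ℂ] F)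
    (hT : ∀ (a : A) (x : E), a • x = 0 → a • T x = 0) (a : A) (x : E) :
    T (a • x) = a • T x := by
  refine eq_of_forall_rankOne_smul_eq π r hπ hr N fun ξ η => ?_
  have hra : r ξ η * a = r ξ ((π a).adjoint η) := hπ <| by
    rw [map_mul, hr, hr, ContinuousLinearMap.mul_def, rankOne_comp]
  have hl := map_smul_of_rankOne π r hπ hr M N T hT
  rw [← hl, ← M.mul_smul, ← N.mul_smul, hra, hl]

/-- An orthogonality preserving pair of `A`-linear maps scales the inner product. -/
theorem exists_inner_map_eq_smul (hπ : Function.Injective π)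
    (hr : ∀ ξ η, π (r ξ η) = rankOne ℂ ξ η)
    (M : CStarInnerProductModule A E) (N : CStarInnerProductModule A F) (T S : E →ₗ[ℂ] F)
    (hT : ∀ (a : A) (x : E), T (a • x) = a • T x) (hS : ∀ (a : A) (x : E), S (a • x) = a • S x)
    (h : ∀ x y, M.inner x y = 0 → N.inner (T x) (S y) = 0) :
    ∃ γ : ℂ, ∀ x y, N.inner (T x) (S y) = γ • M.inner x y := by
  rcases subsingleton_or_nontrivial H with hH | hH
  · exact ⟨0, fun x y => hπ (Subsingleton.elim _ _)⟩
  obtain ⟨e, he⟩ := exists_ne (0 : H)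
  have hM (ξ η : H) (x y : E) : π (M.inner (r e ξ • x) (r e η • y)) =
      ⟪ξ, π (M.inner x y) η⟫_ℂ • rankOne ℂ e e := by
    rw [M.smulA_left, M.inner_smulA_right, ← mul_assoc, π.map_rankOne_mul_mul_star r hr]
  have hN (ξ η : H) (x y : E) : π (N.inner (T (r e ξ • x)) (S (r e η • y))) =
      ⟪ξ, π (N.inner (T x) (S y)) η⟫_ℂ • rankOne ℂ e e := by
    rw [hT, hS, N.smulA_left, N.inner_smulA_right, ← mul_assoc, π.map_rankOne_mul_mul_star r hr]
  obtain ⟨γ, hγ⟩ := LinearMap.exists_eq_smul_of_forall_eq_zero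
    (M.innerₛₗ.compr₂ₛₗ (π.matrixCoeff e e))
    (((N.innerₛₗ.comp T).compl₂ S).compr₂ₛₗ (π.matrixCoeff e e)) (fun x y hxy => by
      replace hxy : ⟪e, π (M.inner x y) e⟫_ℂ = 0 := hxy
      change ⟪e, π (N.inner (T x) (S y)) e⟫_ℂ = 0
      have h₁ := h (r e e • x) (r e e • y) (hπ (by rw [hM, hxy, zero_smul, map_zero]))
      have h₂ := hN e e x y
      rw [h₁, map_zero, eq_comm, smul_eq_zero] at h₂
      exact h₂.resolve_right (rankOne_ne_zero he he))
  replace hγ : ∀ x y, ⟪e, π (N.inner (T x) (S y)) e⟫_ℂ =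
    γ * ⟪e, π (M.inner x y) e⟫_ℂ := hγ
  refine ⟨γ, fun x y => hπ <| ContinuousLinearMap.ext fun η => ext_inner_left ℂ fun ξ => ?_⟩
  have h₁ := hγ (r e ξ • x) (r e η • y)
  rw [hM, hN] at h₁
  simpa [inner_smul_right, ← mul_assoc, he] using h₁

end Standard

end CStarInnerProductModule

/-- **Theorem 3.9**: let `A` be a standard C*-algebra on a Hilbert space `H` (realized via an
isometric star homomorphism `π : A → B(H)` whose range contains all compact operators), let
`E, F` be inner product `A`-modules, and let `T, S : E → F` be two nonzero local mappings.
Then the orthogonality preserving property of `(T, S)` is equivalent to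
`⟪T x, S x⟫ = γ • ⟪x, x⟫` for all `x` and some `γ ∈ ℂ`, and equivalent to
`⟪T x, S y⟫ = γ • ⟪x, y⟫` for all `x, y` and some `γ ∈ ℂ`; under these conditions the maps
`T` and `S` are `A`-linear. -/
theorem standard_orthogonality_preserving_local_pair_tfae
    {H : Type*} [NormedAddCommGroup H] [InnerProductSpace ℂ H] [CompleteSpace H]
    {A E F : Type*} [NonUnitalCStarAlgebra A] [PartialOrder A] [StarOrderedRing A]
    (π : A →⋆ₙₐ[ℂ] (H →L[ℂ] H)) (hπ : Isometry π)
    (hcpt : ∀ f : H →L[ℂ] H, IsCompactOperator (⇑f) → f ∈ Set.range π)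
    [AddCommGroup E] [Module ℂ E] [SMul A E]
    [AddCommGroup F] [Module ℂ F] [SMul A F]
    (ME : CStarInnerProductModule A E) (MF : CStarInnerProductModule A F)
    (T S : E → F) (hT : T ≠ 0) (hS : S ≠ 0)
    (hTadd : ∀ x y : E, T (x + y) = T x + T y)
    (hTsmulC : ∀ (c : ℂ) (x : E), T (c • x) = c • T x)
    (hTlocal : ∀ (a : A) (x : E), a • x = 0 → a • T x = 0)
    (hSadd : ∀ x y : E, S (x + y) = S x + S y)
    (hSsmulC : ∀ (c : ℂ) (x : E), S (c • x) = c • S x)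
    (hSlocal : ∀ (a : A) (x : E), a • x = 0 → a • S x = 0) :
    List.TFAE
      [ ∀ x y : E, ME.inner x y = 0 → MF.inner (T x) (S y) = 0,
        ∃ γ : ℂ, ∀ x : E, MF.inner (T x) (S x) = γ • ME.inner x x,
        ∃ γ : ℂ, ∀ x y : E, MF.inner (T x) (S y) = γ • ME.inner x y ] ∧
    ((∀ x y : E, ME.inner x y = 0 → MF.inner (T x) (S y) = 0) →
      (∀ (a : A) (x : E), T (a • x) = a • T x) ∧
      (∀ (a : A) (x : E), S (a • x) = a • S x)) := by
  have hinj : Function.Injective π := hπ.injective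
  choose r hr using fun ξ η : H =>
    hcpt _ (InnerProductSpace.isCompactOperator_rankOne_s8 ξ η)
  let T' : E →ₗ[ℂ] F := ⟨⟨T, hTadd⟩, hTsmulC⟩
  let S' : E →ₗ[ℂ] F := ⟨⟨S, hSadd⟩, hSsmulC⟩
  have hTA : ∀ (a : A) (x : E), T (a • x) = a • T x :=
    CStarInnerProductModule.map_smul_of_local π r hinj hr ME MF T' hTlocal
  have hSA : ∀ (a : A) (x : E), S (a • x) = a • S x :=
    CStarInnerProductModule.map_smul_of_local π r hinj hr ME MF S' hSlocal
  refine ⟨?_, fun _ => ⟨hTA, hSA⟩⟩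
  tfae_have 1 → 3 :=
    CStarInnerProductModule.exists_inner_map_eq_smul π r hinj hr ME MF T' S' hTA hSA
  tfae_have 3 → 2 := fun ⟨γ, h⟩ => ⟨γ, fun x => h x x⟩
  tfae_have 2 → 3 := fun ⟨γ, h⟩ => by
    have hD := LinearMap.eq_zero_of_forall_apply_self_eq_zero
      ((MF.innerₛₗ.comp T').compl₂ S' - γ • ME.innerₛₗ) fun x => sub_eq_zero.2 (h x)
    exact ⟨γ, fun x y => sub_eq_zero.1 (LinearMap.congr_fun₂ hD x y)⟩
  tfae_have 3 → 1 := fun ⟨γ, h⟩ x y hxy => by rw [h, hxy, smul_zero]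
  tfae_finish
end

section
/- Let A be a C*-algebra and let E and F be full Hilbert A-modules. Suppose T, S : E → F are two nonzero bounded A-linear mappings such that for all x, y ∈ E, ⟨x, y⟩ = 0 implies ⟨T(x), S(y)⟩ = 0. Then there exists an element γ of the center Z(M(A)) of the multiplier algebra M(A) of A such that ⟨T(x), S(y)⟩ = γ·⟨x, y⟩ for all x, y ∈ E (the product γ·⟨x,y⟩ taken in M(A) via the canonical embedding of A, and lying in A). -/
open MultiplierAlgebra

/-- A Hilbert module over a C*-algebra `A`: a (left) `A`-module `E` together with an `A`-valued
inner product which is `ℂ`-linear and `A`-linear in the first variable, conjugate symmetric and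
positive definite, such that the norm of `E` is the induced norm `‖x‖ = ‖⟪x, x⟫‖^(1/2)`
(completeness is the type class `CompleteSpace E`). -/
structure CStarNormedInnerProductModule (A E : Type*) [NonUnitalCStarAlgebra A]
    [PartialOrder A] [StarOrderedRing A]
    [NormedAddCommGroup E] [Module ℂ E] [SMul A E] where
  inner : E → E → A
  add_left : ∀ x y z : E, inner (x + y) z = inner x z + inner y z
  smulC_left : ∀ (c : ℂ) (x y : E), inner (c • x) y = c • inner x y
  smulA_left : ∀ (a : A) (x y : E), inner (a • x) y = a * inner x y
  star_inner : ∀ x y : E, star (inner x y) = inner y x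
  inner_self_nonneg : ∀ x : E, 0 ≤ inner x x
  inner_self_eq_zero : ∀ x : E, inner x x = 0 ↔ x = 0
  smul_add : ∀ (a : A) (x y : E), a • (x + y) = a • x + a • y
  add_smul : ∀ (a b : A) (x : E), (a + b) • x = a • x + b • x
  mul_smul : ∀ (a b : A) (x : E), (a * b) • x = a • (b • x)
  smul_assoc : ∀ (c : ℂ) (a : A) (x : E), (c • a) • x = c • (a • x)
  norm_eq : ∀ x : E, ‖x‖ ^ 2 = ‖inner x x‖

/-- A Hilbert C*-module is *full* when the closed linear span of all inner products is the
whole coefficient algebra. -/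
def CStarNormedInnerProductModule.IsFull {A E : Type*} [NonUnitalCStarAlgebra A]
    [PartialOrder A] [StarOrderedRing A] [NormedAddCommGroup E] [Module ℂ E] [SMul A E]
    (M : CStarNormedInnerProductModule A E) : Prop :=
  (Submodule.span ℂ {a : A | ∃ x y : E, a = M.inner x y}).topologicalClosure = ⊤

section Commutators

variable {A : Type*} [CStarAlgebra A]

theorem CStarAlgebra.commute_of_commute_commutator_of_mem_unitary {u c : A} (hu : u ∈ unitary A)
    (hw : Commute u (u * c - c * u)) : Commute u c := by
  set w := u * c - c * u with hw_def
  have hpow (n : ℕ) : u ^ (n + 1) * c = c * u ^ (n + 1) + ((n : ℂ) + 1) • (w * u ^ n) := by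
    induction n with
    | zero => simp [w]
    | succ n ih =>
      have h₁ : u ^ (n + 1 + 1) * c = u * (u ^ (n + 1) * c) := by rw [pow_succ']; noncomm_ring
      have h₂ : u * c = c * u + w := by simp [w]
      have h₃ : u * (w * u ^ n) = w * u ^ (n + 1) := by
        rw [← mul_assoc, hw.eq, pow_succ', mul_assoc]
      rw [h₁, ih, mul_add, ← mul_assoc, h₂, mul_smul_comm, h₃, add_mul, mul_assoc, ← pow_succ']
      push_cast
      module
  have hbound (n : ℕ) : ((n : ℝ) + 1) * ‖w‖ ≤ 2 * ‖c‖ := by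
    have hun (k : ℕ) : u ^ k ∈ unitary A := pow_mem hu k
    have h : ((n : ℂ) + 1) • (w * u ^ n) = u ^ (n + 1) * c - c * u ^ (n + 1) := by
      rw [hpow]; abel
    calc ((n : ℝ) + 1) * ‖w‖ = ‖((n : ℂ) + 1) • (w * u ^ n)‖ := by
          rw [norm_smul, CStarRing.norm_mul_mem_unitary _ (hun n)]
          congr 1
          exact_mod_cast (Complex.norm_natCast (n + 1)).symm
      _ ≤ ‖u ^ (n + 1) * c‖ + ‖c * u ^ (n + 1)‖ := h ▸ norm_sub_le _ _
      _ = 2 * ‖c‖ := by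
          rw [CStarRing.norm_mem_unitary_mul _ (hun _), CStarRing.norm_mul_mem_unitary _ (hun _)]
          ring
  have hw0 : w = 0 := by
    by_contra hne
    have hpos : 0 < ‖w‖ := norm_pos_iff.mpr hne
    obtain ⟨n, hn⟩ := exists_nat_gt (2 * ‖c‖ / ‖w‖)
    rw [div_lt_iff₀ hpos] at hn
    linarith [hbound n]
  exact sub_eq_zero.mp hw0

theorem IsSelfAdjoint.commute_of_commute_commutator {h c : A} (hh : IsSelfAdjoint h)
    (hc : Commute h (h * c - c * h)) : Commute h c := by
  set v : A := h + algebraMap ℂ A Complex.I with hv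
  have hvh : Commute v h := (Commute.refl h).add_left (Algebra.commutes _ _)
  have hsv : star v = h - algebraMap ℂ A Complex.I := by
    rw [hv, star_add, hh.star_eq, ← algebraMap_star_comm]
    simp [sub_eq_add_neg]
  have hunit : IsUnit v := by
    have h₁ : -Complex.I ∉ spectrum ℂ h := fun hmem => by
      have := hh.mem_spectrum_eq_re hmem
      simpa using congrArg Complex.im this
    have h₂ := spectrum.notMem_iff.mp h₁
    rw [← IsUnit.neg_iff] at h₂
    convert h₂ using 1
    simp [hv]
  obtain ⟨r, hvr, hrv⟩ : ∃ r, v * r = 1 ∧ r * v = 1 := by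
    obtain ⟨U, hU⟩ := hunit
    exact ⟨↑U⁻¹, by simp [← hU], by simp [← hU]⟩
  have comm_r {x : A} (hx : Commute h x) : Commute r x := by
    have hvx : v * x = x * v := (hx.add_left (Algebra.commutes _ _)).eq
    calc r * x = r * (x * v) * r := by rw [mul_assoc, mul_assoc, hvr, mul_one]
      _ = x * r := by rw [← hvx, ← mul_assoc, hrv, one_mul]
  have hu_eq : star v * r = 1 - (2 * Complex.I) • r := by
    have : star v = v - (2 * Complex.I) • (1 : A) := by
      rw [hsv, hv, Algebra.algebraMap_eq_smul_one]; module
    rw [this, sub_mul, hvr, smul_mul_assoc, one_mul]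
  have hsvv : star v * v = v * star v := by
    rw [hsv]
    exact (hvh.sub_right (Algebra.commutes _ _).symm).symm.eq
  have hu : star v * r ∈ unitary A := by
    have hvr' : star r * star v = 1 := by rw [← star_mul, hvr, star_one]
    have hrv' : star v * star r = 1 := by rw [← star_mul, hrv, star_one]
    rw [Unitary.mem_iff]
    constructor
    · calc star (star v * r) * (star v * r) = star r * (v * star v) * r := by
            rw [star_mul, star_star]; noncomm_ring
        _ = (star r * star v) * (v * r) := by rw [← hsvv]; noncomm_ring
        _ = 1 := by rw [hvr', hvr, one_mul]
    · have hrsv : r * star v = star v * r := by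
        rw [hsv]
        exact (comm_r ((Commute.refl h).sub_right (Algebra.commutes _ _).symm)).eq
      calc star v * r * star (star v * r) = r * star v * (star r * v) := by
            rw [hrsv, star_mul, star_star]
        _ = r * (star v * star r) * v := by noncomm_ring
        _ = 1 := by rw [hrv', mul_one, hrv]
  have hcomm_eq : (star v * r) * c - c * (star v * r) =
      (2 * Complex.I) • (r * (h * c - c * h) * r) := by
    have h₁ : h * c - c * h = v * c - c * v := by
      rw [hv, add_mul, mul_add, Algebra.commutes]; abel
    have h₂ : r * (v * c - c * v) * r = c * r - r * c := by
      calc r * (v * c - c * v) * r = (r * v) * c * r - r * c * (v * r) := by noncomm_ring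
        _ = c * r - r * c := by rw [hvr, hrv, one_mul, mul_one]
    rw [h₁, h₂, hu_eq, sub_mul, mul_sub, one_mul, mul_one, smul_mul_assoc, mul_smul_comm]
    module
  have hr_h : Commute h r := (comm_r (Commute.refl h)).symm
  have hcu := CStarAlgebra.commute_of_commute_commutator_of_mem_unitary hu (c := c) <| by
    rw [hcomm_eq, hu_eq]
    refine (Commute.one_left _).sub_left (Commute.smul_left (Commute.smul_right ?_ _) _)
    exact comm_r ((hr_h.mul_right hc).mul_right hr_h)
  have hzero : r * (h * c - c * h) * r = 0 := by
    have h₀ := hcomm_eq.symm.trans (sub_eq_zero.mpr hcu.eq)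
    exact (smul_eq_zero.mp h₀).resolve_left (by simp)
  refine sub_eq_zero.mp ?_
  calc h * c - c * h = (v * r) * (h * c - c * h) * (r * v) := by rw [hvr, hrv, one_mul, mul_one]
    _ = v * (r * (h * c - c * h) * r) * v := by noncomm_ring
    _ = 0 := by rw [hzero, mul_zero, zero_mul]

end Commutators

theorem IsSelfAdjoint.commute_of_cubic_commutator_eq_zero {A : Type*} [NonUnitalCStarAlgebra A]
    {h b : A} (hh : IsSelfAdjoint h)
    (hb : h * h * h * b - b * (h * h * h) = (3 : ℝ) • (h * h * b * h - h * b * (h * h))) :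
    Commute h b := by
  let H : Unitization ℂ A := h
  let X : Unitization ℂ A := b
  have hH : IsSelfAdjoint H := by
    rw [isSelfAdjoint_iff, ← Unitization.inr_star, hh.star_eq]
  have hX : H * H * H * X - X * (H * H * H) = (3 : ℝ) • (H * H * X * H - H * X * (H * H)) := by
    have := congrArg (Unitization.inr (R := ℂ)) hb
    simpa only [Unitization.inr_mul, Unitization.inr_sub, Unitization.inr_smul] using this
  have h₁ : Commute H (H * (H * X - X * H) - (H * X - X * H) * H) := by
    refine sub_eq_zero.mp ?_
    calc _ = (H * H * H * X - X * (H * H * H)) -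
          (3 : ℝ) • (H * H * X * H - H * X * (H * H)) := by
            have : (3 : ℝ) • (H * H * X * H - H * X * (H * H)) =
              (3 : ℕ) • (H * H * X * H - H * X * (H * H)) := by
              rw [← Nat.cast_smul_eq_nsmul ℝ]; norm_num
            rw [this]
            noncomm_ring
      _ = 0 := sub_eq_zero.mpr hX
  have h₂ : Commute H X :=
    hH.commute_of_commute_commutator (hH.commute_of_commute_commutator h₁)
  refine Unitization.inr_injective (R := ℂ) ?_
  simpa only [Unitization.inr_mul] using h₂.eq

section SpectralTail

variable {A : Type*} [NonUnitalCStarAlgebra A]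

/-- The element `(h - s)₊`, defined in the nonunital functional calculus when `0 ≤ s`. -/
noncomputable def spectralTail (h : A) (s : ℝ) : A := cfcₙ (fun t : ℝ ↦ max (t - s) 0) h

/-- A bounded function of `h` which inverts `h` on the support of `spectralTail h s`. -/
noncomputable def spectralTailInverse (h : A) (s : ℝ) : A :=
  cfcₙ (fun t : ℝ ↦ t / max t s ^ 2) h

theorem continuous_div_max_sq {s : ℝ} (hs : 0 < s) :
    Continuous fun t : ℝ ↦ t / max t s ^ 2 := by
  refine continuous_id.div (by fun_prop) fun t ↦ ?_
  have : 0 < max t s := lt_max_of_lt_right hs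
  positivity

theorem IsSelfAdjoint.spectralTail (h : A) (s : ℝ) : IsSelfAdjoint (spectralTail h s) :=
  cfcₙ_predicate _ h

theorem IsSelfAdjoint.norm_le_of_mem_quasispectrum {h : A} (hh : IsSelfAdjoint h) {t : ℝ}
    (ht : t ∈ quasispectrum ℝ h) : |t| ≤ ‖h‖ := by
  have := norm_apply_le_norm_cfcₙ (fun t : ℝ ↦ t) h ht
  rwa [cfcₙ_id' ℝ h] at this

theorem Commute.spectralTail {h b : A} (hb : Commute h b) (s : ℝ) :
    Commute (spectralTail h s) b :=
  hb.cfcₙ_real _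

theorem spectralTail_mul_self {h : A} (hh : IsSelfAdjoint h) {s : ℝ} (hs : 0 ≤ s) :
    spectralTail h s * h * spectralTail h s =
      spectralTail h s * h * h - s • (spectralTail h s * h) := by
  have hp0 : max (0 - s) 0 = 0 := by simp [hs]
  have hid : cfcₙ (fun t : ℝ ↦ t) h = h := cfcₙ_id' ℝ h
  have h₁ : spectralTail h s * h = cfcₙ (fun t : ℝ ↦ max (t - s) 0 * t) h := by
    rw [cfcₙ_mul _ _ h, hid]; rfl
  have h₂ : spectralTail h s * h * spectralTail h s =
      cfcₙ (fun t : ℝ ↦ max (t - s) 0 * t * max (t - s) 0) h := by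
    rw [cfcₙ_mul (fun t : ℝ ↦ max (t - s) 0 * t) _ h, h₁]; rfl
  have h₃ : spectralTail h s * h * h = cfcₙ (fun t : ℝ ↦ max (t - s) 0 * t * t) h := by
    rw [cfcₙ_mul (fun t : ℝ ↦ max (t - s) 0 * t) _ h, h₁, hid]
  rw [h₂, h₃, h₁, ← cfcₙ_smul s _ h, ← cfcₙ_sub _ _ h]
  refine cfcₙ_congr fun t _ ↦ ?_
  rcases le_total (t - s) 0 with ht | ht
  · simp [max_eq_right ht]
  · simp only [max_eq_left ht, smul_eq_mul]; ring

theorem spectralTailInverse_mul_mul {h : A} (hh : IsSelfAdjoint h) {s : ℝ} (hs : 0 < s) :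
    spectralTailInverse h s * h * spectralTail h s = spectralTail h s := by
  have hp0 : max (0 - s) 0 = 0 := by simp [hs.le]
  have hk := continuous_div_max_sq hs
  have hid : cfcₙ (fun t : ℝ ↦ t) h = h := cfcₙ_id' ℝ h
  have h₁ : spectralTailInverse h s * h = cfcₙ (fun t : ℝ ↦ t / max t s ^ 2 * t) h := by
    rw [cfcₙ_mul _ _ h hk.continuousOn (by simp), hid]; rfl
  rw [h₁, spectralTail, ← cfcₙ_mul (fun t : ℝ ↦ t / max t s ^ 2 * t) (fun t : ℝ ↦ max (t - s) 0) h
    (by fun_prop) (by simp) (by fun_prop) hp0]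
  refine cfcₙ_congr fun t _ ↦ ?_
  rcases le_total (t - s) 0 with ht | ht
  · simp [max_eq_right ht]
  · have hts : s ≤ t := by linarith
    have : t ≠ 0 := by linarith
    simp only [max_eq_left hts]
    field_simp

theorem norm_spectralTailInverse_le [PartialOrder A] [StarOrderedRing A] {h : A} (hh : 0 ≤ h)
    {s : ℝ} (hs : 0 < s) : ‖spectralTailInverse h s‖ ≤ s⁻¹ := by
  refine norm_cfcₙ_le fun t ht ↦ ?_
  have ht₀ := quasispectrum_nonneg_of_nonneg h hh t ht
  have hm : 0 < max t s := lt_max_of_lt_right hs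
  rw [Real.norm_eq_abs, abs_of_nonneg (by positivity), div_le_iff₀ (by positivity), pow_two]
  calc t ≤ max t s := le_max_left _ _
    _ = s⁻¹ * (s * max t s) := by field_simp
    _ ≤ s⁻¹ * (max t s * max t s) := by gcongr; exact le_max_right _ _

theorem norm_le_of_spectralTail_eq_zero [PartialOrder A] [StarOrderedRing A] {h : A} (hh : 0 ≤ h)
    {s : ℝ} (hs : 0 ≤ s) (hz : spectralTail h s = 0) : ‖h‖ ≤ s := by
  have hp0 : max (0 - s) 0 = 0 := by simp [hs]
  have hsa : IsSelfAdjoint h := .of_nonneg hh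
  have hid : cfcₙ (fun t : ℝ ↦ t) h = h := cfcₙ_id' ℝ h
  have : h = cfcₙ (fun t : ℝ ↦ t - max (t - s) 0) h := by
    rw [cfcₙ_sub _ _ h, hid, ← spectralTail, hz, sub_zero]
  rw [this]
  refine norm_cfcₙ_le fun t ht ↦ ?_
  have := quasispectrum_nonneg_of_nonneg h hh t ht
  rw [Real.norm_eq_abs, abs_le]
  rcases le_total (t - s) 0 with ht' | ht'
  · rw [max_eq_right ht']; constructor <;> linarith
  · rw [max_eq_left ht']; constructor <;> linarith

theorem intervalIntegrable_spectralTail {h : A} (hh : IsSelfAdjoint h) (R : ℝ) (hR : 0 ≤ R) :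
    IntervalIntegrable (spectralTail h) MeasureTheory.volume 0 R := by
  rw [intervalIntegrable_iff_integrableOn_Ioc_of_le hR]
  refine integrableOn_cfcₙ measurableSet_Ioc (fun s t : ℝ ↦ max (t - s) 0) (fun _ ↦ ‖h‖) h
    (by fun_prop) ?_ ?_ ?_
  · filter_upwards [MeasureTheory.ae_restrict_mem measurableSet_Ioc] with s hs
    simp [hs.1.le]
  · filter_upwards [MeasureTheory.ae_restrict_mem measurableSet_Ioc] with s hs t ht
    have := hh.norm_le_of_mem_quasispectrum ht
    rw [abs_le] at this
    rw [Real.norm_eq_abs, abs_of_nonneg (le_max_right _ _)]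
    exact max_le (by linarith [hs.1]) (norm_nonneg _)
  · exact MeasureTheory.HasFiniteIntegral.of_bounded (C := ‖h‖) (by simp)

theorem intervalIntegral_max_sub (f : ℝ → ℝ) (hf : Continuous f) {t R : ℝ} (ht : 0 ≤ t)
    (htR : t ≤ R) : ∫ s in (0 : ℝ)..R, f s * max (t - s) 0 = ∫ s in (0 : ℝ)..t, f s * (t - s) := by
  have hc : Continuous fun s ↦ f s * max (t - s) 0 := by fun_prop
  rw [← intervalIntegral.integral_add_adjacent_intervals (b := t)
    (hc.intervalIntegrable _ _) (hc.intervalIntegrable _ _)]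
  have h₁ : ∫ s in t..R, f s * max (t - s) 0 = 0 := by
    rw [intervalIntegral.integral_congr (g := fun _ ↦ (0 : ℝ))]
    · simp
    · intro s hs
      rw [Set.uIcc_of_le htR] at hs
      simp [max_eq_right (sub_nonpos.mpr hs.1)]
  rw [h₁, add_zero]
  refine intervalIntegral.integral_congr fun s hs ↦ ?_
  rw [Set.uIcc_of_le ht] at hs
  simp [max_eq_left (sub_nonneg.mpr hs.2)]

variable [PartialOrder A] [StarOrderedRing A]

theorem integral_smul_spectralTail {h : A} (hh : 0 ≤ h) (f : ℝ → ℝ) (hf : Continuous f) :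
    ∫ s in (0 : ℝ)..‖h‖, f s • spectralTail h s =
      cfcₙ (fun t : ℝ ↦ ∫ s in (0 : ℝ)..t, f s * (t - s)) h := by
  have hsa : IsSelfAdjoint h := .of_nonneg hh
  obtain ⟨C, hC⟩ := isCompact_Icc.exists_bound_of_continuousOn (s := Set.Icc 0 ‖h‖)
    hf.continuousOn
  have h₁ := cfcₙ_setIntegral (μ := MeasureTheory.volume) (s := Set.Ioc 0 ‖h‖) measurableSet_Ioc
    (fun s t : ℝ ↦ f s * max (t - s) 0) (fun _ ↦ C * ‖h‖) h (by fun_prop) ?_ ?_ ?_ hsa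
  · rw [intervalIntegral.integral_of_le (norm_nonneg h)]
    convert h₁.symm using 1
    · refine MeasureTheory.setIntegral_congr_fun measurableSet_Ioc fun s hs ↦ ?_
      exact (cfcₙ_smul (f s) (fun t : ℝ ↦ max (t - s) 0) h (by fun_prop)
        (by simp [hs.1.le])).symm
    · refine cfcₙ_congr fun t ht ↦ ?_
      have ht₀ := quasispectrum_nonneg_of_nonneg h hh t ht
      have ht₁ := (le_abs_self t).trans (hsa.norm_le_of_mem_quasispectrum ht)
      rw [← intervalIntegral_max_sub f hf ht₀ ht₁, intervalIntegral.integral_of_le (norm_nonneg h)]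
  · filter_upwards [MeasureTheory.ae_restrict_mem measurableSet_Ioc] with s hs
    simp [hs.1.le]
  · filter_upwards [MeasureTheory.ae_restrict_mem measurableSet_Ioc] with s hs t ht
    have := (le_abs_self t).trans (hsa.norm_le_of_mem_quasispectrum ht)
    rw [norm_mul, Real.norm_eq_abs (max _ _), abs_of_nonneg (le_max_right _ _)]
    have h₂ := hC s ⟨hs.1.le, hs.2⟩
    have : max (t - s) 0 ≤ ‖h‖ := max_le (by linarith [hs.1]) (norm_nonneg _)
    gcongr
    exact (norm_nonneg _).trans h₂
  · exact MeasureTheory.HasFiniteIntegral.of_bounded (C := ‖C * ‖h‖‖) (by simp)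

theorem integral_spectralTail {h : A} (hh : 0 ≤ h) :
    ∫ s in (0 : ℝ)..‖h‖, spectralTail h s = (1 / 2 : ℝ) • (h * h) := by
  have hsa : IsSelfAdjoint h := .of_nonneg hh
  have h₁ := integral_smul_spectralTail hh (fun _ ↦ 1) (by fun_prop)
  simp only [one_smul, one_mul] at h₁
  rw [h₁]
  have h₂ : h * h = cfcₙ (fun t : ℝ ↦ t * t) h := by rw [cfcₙ_mul _ _ h, cfcₙ_id' ℝ h]
  rw [h₂, ← cfcₙ_smul _ _ h]
  refine cfcₙ_congr fun t _ ↦ ?_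
  rw [intervalIntegral.integral_sub (by simp) (by simp), intervalIntegral.integral_const,
    integral_id]
  simp only [smul_eq_mul]
  ring

theorem integral_id_smul_spectralTail {h : A} (hh : 0 ≤ h) :
    ∫ s in (0 : ℝ)..‖h‖, s • spectralTail h s = (1 / 6 : ℝ) • (h * h * h) := by
  have hsa : IsSelfAdjoint h := .of_nonneg hh
  rw [integral_smul_spectralTail hh (fun s ↦ s) (by fun_prop)]
  have h₂ : h * h * h = cfcₙ (fun t : ℝ ↦ t * t * t) h := by
    rw [cfcₙ_mul (fun t : ℝ ↦ t * t) _ h, cfcₙ_mul _ _ h, cfcₙ_id' ℝ h]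
  rw [h₂, ← cfcₙ_smul _ _ h]
  refine cfcₙ_congr fun t _ ↦ ?_
  have : ∀ s : ℝ, s * (t - s) = t * s - s ^ 2 := fun s ↦ by ring
  simp only [this]
  rw [intervalIntegral.integral_sub
    (Continuous.intervalIntegrable (by fun_prop) _ _)
    (Continuous.intervalIntegrable (by fun_prop) _ _), intervalIntegral.integral_const_mul, integral_id, integral_pow]
  simp only [smul_eq_mul]
  ring

/-- If `b` intertwines the spectral tails of `h` in the way that a function of `h` does, then it
commutes with `h`. -/
theorem commute_of_spectralTail {h b : A} (hh : 0 ≤ h)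
    (hb : ∀ s : ℝ, 0 < s → spectralTail h s * b * h - s • (spectralTail h s * b) =
      h * b * spectralTail h s - s • (b * spectralTail h s)) : Commute h b := by
  have hsa : IsSelfAdjoint h := .of_nonneg hh
  have hint := intervalIntegrable_spectralTail hsa ‖h‖ (norm_nonneg h)
  have hint' : IntervalIntegrable (fun s ↦ s • spectralTail h s) MeasureTheory.volume 0 ‖h‖ :=
    hint.continuousOn_smul continuousOn_id
  have hcongr : ∫ s in (0 : ℝ)..‖h‖, (spectralTail h s * (b * h) - (s • spectralTail h s) * b) =
      ∫ s in (0 : ℝ)..‖h‖, ((h * b) * spectralTail h s - b * (s • spectralTail h s)) := by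
    refine intervalIntegral.integral_congr_uIoo fun s hs ↦ ?_
    rw [Set.uIoo_of_le (norm_nonneg h)] at hs
    simpa only [mul_assoc, smul_mul_assoc, mul_smul_comm] using hb s hs.1
  have hR (y : A) {f : ℝ → A} (hf : IntervalIntegrable f MeasureTheory.volume 0 ‖h‖) :
      IntervalIntegrable (fun s ↦ f s * y) MeasureTheory.volume 0 ‖h‖ ∧
        ∫ s in (0 : ℝ)..‖h‖, f s * y = (∫ s in (0 : ℝ)..‖h‖, f s) * y :=
    ⟨⟨((ContinuousLinearMap.mul ℝ A).flip y).integrable_comp hf.1,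
        ((ContinuousLinearMap.mul ℝ A).flip y).integrable_comp hf.2⟩,
      ((ContinuousLinearMap.mul ℝ A).flip y).intervalIntegral_comp_comm hf⟩
  have hL (y : A) {f : ℝ → A} (hf : IntervalIntegrable f MeasureTheory.volume 0 ‖h‖) :
      IntervalIntegrable (fun s ↦ y * f s) MeasureTheory.volume 0 ‖h‖ ∧
        ∫ s in (0 : ℝ)..‖h‖, y * f s = y * ∫ s in (0 : ℝ)..‖h‖, f s :=
    ⟨⟨(ContinuousLinearMap.mul ℝ A y).integrable_comp hf.1,
        (ContinuousLinearMap.mul ℝ A y).integrable_comp hf.2⟩,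
      (ContinuousLinearMap.mul ℝ A y).intervalIntegral_comp_comm hf⟩
  rw [intervalIntegral.integral_sub (hR _ hint).1 (hR _ hint').1,
    intervalIntegral.integral_sub (hL _ hint).1 (hL _ hint').1, (hR _ hint).2, (hR _ hint').2,
    (hL _ hint).2, (hL _ hint').2, integral_spectralTail hh, integral_id_smul_spectralTail hh]
    at hcongr
  refine hsa.commute_of_cubic_commutator_eq_zero ?_
  have := congrArg (fun x : A ↦ (6 : ℝ) • x) hcongr
  simp only [smul_sub, smul_mul_assoc, mul_smul_comm, smul_smul] at this
  norm_num at this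
  simp only [mul_assoc, smul_sub] at this ⊢
  rw [sub_eq_sub_iff_add_eq_add] at this ⊢
  rw [← sub_eq_zero] at this ⊢
  rw [← neg_eq_zero, ← this]
  abel

end SpectralTail

section SesquilinearForm

variable {A : Type*} [NonUnitalCStarAlgebra A]

theorem mul_mul_star_eq_zero_of_mul_mul_eq_zero {g s : A} (h : ∀ v, g * v * s = 0) (w : A) :
    s * w * star g = 0 := by
  rw [← CStarRing.star_mul_self_eq_zero_iff]
  rw [show star (s * w * star g) * (s * w * star g) = g * (star w * star s) * s * (w * star g) by
    simp only [star_mul, star_star, mul_assoc], h, zero_mul]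

variable {E : Type*} [AddCommGroup E] [Module ℂ E] [SMul A E]

/-- An `A`-valued form on `E` which is linear over `ℂ` and `A` in the first variable and
conjugate linear in the second. -/
structure IsModuleForm (B : E → E → A) : Prop where
  add_left : ∀ x y z, B (x + y) z = B x z + B y z
  add_right : ∀ x y z, B x (y + z) = B x y + B x z
  smulC_left : ∀ (c : ℂ) x y, B (c • x) y = c • B x y
  smulC_right : ∀ (c : ℂ) x y, B x (c • y) = star c • B x y
  smulA_left : ∀ (a : A) x y, B (a • x) y = a * B x y
  smulA_right : ∀ (a : A) x y, B x (a • y) = B x y * star a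

namespace IsModuleForm

variable {B : E → E → A}

theorem swap (hB : IsModuleForm B) : IsModuleForm fun x y ↦ star (B y x) where
  add_left x y z := by rw [hB.add_right, star_add]
  add_right x y z := by rw [hB.add_left, star_add]
  smulC_left c x y := by rw [hB.smulC_right, star_smul, star_star]
  smulC_right c x y := by rw [hB.smulC_left, star_smul]
  smulA_left a x y := by rw [hB.smulA_right, star_mul, star_star]
  smulA_right a x y := by rw [hB.smulA_left, star_mul]

theorem sub_left (hB : IsModuleForm B) (x y z : E) : B (x - y) z = B x z - B y z := by
  rw [eq_sub_iff_add_eq, ← hB.add_left, sub_add_cancel]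

theorem sub_right (hB : IsModuleForm B) (x y z : E) : B x (y - z) = B x y - B x z := by
  rw [eq_sub_iff_add_eq, ← hB.add_right, sub_add_cancel]

theorem zero_right (hB : IsModuleForm B) (x : E) : B x 0 = 0 := by
  simpa using hB.sub_right x 0 0

end IsModuleForm

end SesquilinearForm

section HilbertModule

variable {A E : Type*} [NonUnitalCStarAlgebra A] [PartialOrder A] [StarOrderedRing A]
  [NormedAddCommGroup E] [Module ℂ E] [SMul A E]

namespace CStarNormedInnerProductModule

theorem isModuleForm_inner (M : CStarNormedInnerProductModule A E) : IsModuleForm M.inner where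
  add_left := M.add_left
  add_right x y z := by
    rw [← M.star_inner, M.add_left, star_add, M.star_inner, M.star_inner]
  smulC_left := M.smulC_left
  smulC_right c x y := by rw [← M.star_inner, M.smulC_left, star_smul, M.star_inner]
  smulA_left := M.smulA_left
  smulA_right a x y := by rw [← M.star_inner, M.smulA_left, star_mul, M.star_inner]

theorem eq_zero_of_mul_inner_eq_zero {M : CStarNormedInnerProductModule A E} (hM : M.IsFull)
    {a : A} (ha : ∀ x y, a * M.inner x y = 0) : a = 0 := by
  have hle : (Submodule.span ℂ {a : A | ∃ x y : E, a = M.inner x y}).topologicalClosure ≤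
      (LinearMap.mulLeft ℂ a).ker := by
    refine Submodule.topologicalClosure_minimal _ (Submodule.span_le.mpr ?_) ?_
    · rintro _ ⟨x, y, rfl⟩
      exact ha x y
    · exact isClosed_singleton.preimage (continuous_const_mul a)
  rw [hM] at hle
  have : a * star a = 0 := hle (x := star a) trivial
  exact CStarRing.mul_star_self_eq_zero_iff a |>.mp this

variable {M : CStarNormedInnerProductModule A E} {B : E → E → A}

section

variable (hB : IsModuleForm B) (hMB : ∀ x y, M.inner x y = 0 → B x y = 0)
include hB hMB

theorem commute_inner_self (y : E) : Commute (M.inner y y) (B y y) := by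
  have hI := M.isModuleForm_inner
  have hh := M.inner_self_nonneg y
  have hsa : star (M.inner y y) = M.inner y y := M.star_inner y y
  refine commute_of_spectralTail hh fun s hs ↦ ?_
  set h := M.inner y y with hdef
  have hp : star (spectralTail h s) = spectralTail h s := IsSelfAdjoint.spectralTail h s
  have hph := Commute.spectralTail (Commute.refl h) s
  have hpp := spectralTail_mul_self (IsSelfAdjoint.of_nonneg hh) hs.le
  generalize spectralTail h s = p at *
  have h₁ := hMB (p • y) (p • y - h • y + (s : ℂ) • y) (by
    simp only [hI.add_right, hI.sub_right, hI.smulA_left, hI.smulA_right, hI.smulC_right, hp, hsa,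
      ← hdef, RCLike.star_def, Complex.conj_ofReal]
    simp only [Complex.coe_smul, mul_smul_comm, hpp, ← mul_assoc]
    abel)
  have h₂ := hMB (p • y - h • y + (s : ℂ) • y) (p • y) (by
    simp only [hI.add_left, hI.sub_left, hI.smulA_left, hI.smulA_right, hI.smulC_left, hp,
      ← hdef]
    have hhp : h * h * p = p * h * h := by rw [mul_assoc, ← hph.eq, ← mul_assoc, ← hph.eq]
    simp only [Complex.coe_smul, ← mul_assoc, hhp, hpp]
    rw [hph.eq, smul_mul_assoc]
    abel)
  simp only [hB.add_right, hB.sub_right, hB.smulA_left, hB.smulA_right, hB.smulC_right, hp, hsa,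
    RCLike.star_def, Complex.conj_ofReal] at h₁
  simp only [hB.add_left, hB.sub_left, hB.smulA_left, hB.smulA_right, hB.smulC_left, hp] at h₂
  have h₃ := h₂.trans h₁.symm
  simp only [Complex.coe_smul, mul_smul_comm, smul_mul_assoc, mul_assoc] at h₃ ⊢
  rw [← sub_eq_zero] at h₃ ⊢
  rw [← h₃]
  abel

theorem mul_spectralTail_mul_inner_self (x y : E) {s : ℝ} (hs : 0 < s) :
    B x y * spectralTail (M.inner y y) s * M.inner y y =
      M.inner x y * spectralTail (M.inner y y) s * B y y := by
  have hI := M.isModuleForm_inner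
  have hc := commute_inner_self hB hMB y
  have hcp := Commute.spectralTail hc s
  set h := M.inner y y with hdef
  have hp : star (spectralTail h s) = spectralTail h s := IsSelfAdjoint.spectralTail h s
  have hk := spectralTailInverse_mul_mul (IsSelfAdjoint.of_nonneg (M.inner_self_nonneg y)) hs
  have hph := Commute.spectralTail (Commute.refl h) s
  rw [← hdef] at hk
  generalize spectralTail h s = p at *
  generalize spectralTailInverse h s = k at *
  have h₁ := hMB (x - (M.inner x y * k) • y) (p • y) (by
    rw [hI.smulA_right, hI.sub_left, hI.smulA_left, ← hdef, hp, sub_mul, mul_assoc, mul_assoc,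
      ← mul_assoc k, hk, sub_self])
  rw [hB.smulA_right, hB.sub_left, hB.smulA_left, hp, sub_mul, sub_eq_zero] at h₁
  calc B x y * p * h = M.inner x y * (k * (B y y * (p * h))) := by rw [h₁]; simp only [mul_assoc]
    _ = M.inner x y * (k * h * p * B y y) := by
      rw [hph.eq, ← mul_assoc (B y y), ← hc.eq, mul_assoc h, ← hcp.eq]; simp only [mul_assoc]
    _ = _ := by rw [hk, mul_assoc]

theorem mul_inner_self (x y : E) : B x y * M.inner y y = M.inner x y * B y y := by
  have hI := M.isModuleForm_inner
  have hc := commute_inner_self hB hMB y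
  have hh := M.inner_self_nonneg y
  have hsa : star (M.inner y y) = M.inner y y := M.star_inner y y
  have h₁ := fun s (hs : 0 < s) ↦ mul_spectralTail_mul_inner_self hB hMB x y (s := s) hs
  set h := M.inner y y with hdef
  have hint := intervalIntegrable_spectralTail (IsSelfAdjoint.of_nonneg hh) ‖h‖ (norm_nonneg h)
  have hmul (u v : A) : ∫ s in (0 : ℝ)..‖h‖, u * spectralTail h s * v =
      (1 / 2 : ℝ) • (u * (h * h) * v) := by
    have := ((ContinuousLinearMap.mul ℝ A).flip v ∘L
      ContinuousLinearMap.mul ℝ A u).intervalIntegral_comp_comm hint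
    rw [integral_spectralTail hh] at this
    simpa [mul_assoc] using this
  have h₂ : B x y * (h * h) * h = M.inner x y * (h * h) * B y y := by
    have h₃ : ∫ s in (0 : ℝ)..‖h‖, B x y * spectralTail h s * h =
        ∫ s in (0 : ℝ)..‖h‖, M.inner x y * spectralTail h s * B y y := by
      refine intervalIntegral.integral_congr_uIoo fun s hs ↦ ?_
      rw [Set.uIoo_of_le (norm_nonneg h)] at hs
      exact h₁ s hs.1
    rw [hmul, hmul] at h₃
    exact smul_right_injective A (by norm_num) h₃
  set D := B x y * h - M.inner x y * B y y with hD
  have hDhh : D * h * h = 0 := by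
    have h₃ : B y y * h * h = h * h * B y y := by rw [← hc.eq, mul_assoc, ← hc.eq, ← mul_assoc]
    simp only [mul_assoc] at h₂ h₃
    simp only [hD, sub_mul, mul_assoc, h₂, h₃, sub_self]
  have hDh : D * h = 0 := by
    rw [← CStarRing.mul_star_self_eq_zero_iff, star_mul, hsa, ← mul_assoc, hDhh, zero_mul]
  have hDy : D • y = 0 := by
    rw [← M.inner_self_eq_zero, hI.smulA_left, hI.smulA_right, ← hdef, ← mul_assoc, hDh, zero_mul]
  have hDb : D * star (B y y) = 0 := by
    rw [← star_inj, star_mul, star_star, star_zero, ← hB.smulA_right, hDy, hB.zero_right]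
  rw [← sub_eq_zero, ← hD, ← CStarRing.mul_star_self_eq_zero_iff]
  nth_rewrite 2 [hD]
  rw [star_sub, star_mul, star_mul, hsa, mul_sub, ← mul_assoc, ← mul_assoc, hDh, hDb, zero_mul,
    zero_mul, sub_self]

theorem mul_inner_comm_left (x x' y : E) :
    B x y * M.inner x' y = M.inner x y * B x' y := by
  have hI := M.isModuleForm_inner
  have key (c : ℂ) := mul_inner_self hB hMB x (y + c • x')
  simp only [hI.add_left, hI.add_right, hI.smulC_left, hI.smulC_right, hB.add_left, hB.add_right,
    hB.smulC_left, hB.smulC_right, mul_add, add_mul, smul_mul_assoc, mul_smul_comm] at key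
  have h₁ := key 1
  have h₂ := key (-1)
  have h₃ := key Complex.I
  have h₄ := key (-Complex.I)
  simp only [star_one, star_neg, RCLike.star_def, Complex.conj_I, one_smul] at h₁ h₂ h₃ h₄
  have h₆ : (4 : ℂ) • (B x y * M.inner x' y) = (4 : ℂ) • (M.inner x y * B x' y) := by
    linear_combination (norm := skip)
      (1 : ℂ) • h₁ - (1 : ℂ) • h₂ - Complex.I • h₃ + Complex.I • h₄
    match_scalars <;> ring_nf <;> (try simp only [Complex.I_sq]) <;> norm_num
  exact smul_right_injective A (by norm_num : (4 : ℂ) ≠ 0) h₆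

theorem mul_inner_comm_right (x y y' : E) :
    B x y * M.inner x y' = M.inner x y * B x y' := by
  have := mul_inner_comm_left (M := M) hB.swap
    (fun x y hxy ↦ by rw [hMB y x (by rw [← M.star_inner, hxy, star_zero]), star_zero]) y' y x
  rw [← star_inj] at this
  simpa only [star_mul, star_star, M.star_inner] using this.symm

theorem mul_mul_inner_comm_left (u : A) (x x' y : E) :
    B x y * u * M.inner x' y = M.inner x y * u * B x' y := by
  have := mul_inner_comm_left hB hMB x (u • x') y
  rwa [M.smulA_left, hB.smulA_left, ← mul_assoc, ← mul_assoc] at this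

theorem mul_mul_inner_comm_right (u : A) (x y y' : E) :
    B x y * u * M.inner x y' = M.inner x y * u * B x y' := by
  have := mul_inner_comm_right hB hMB x (star u • y) y'
  rwa [M.isModuleForm_inner.smulA_right, hB.smulA_right, star_star] at this

end

theorem mul_inner_comm (hM : M.IsFull) (hB : IsModuleForm B)
    (hMB : ∀ x y, M.inner x y = 0 → B x y = 0) (x y x' y' : E) :
    B x y * M.inner x' y' = M.inner x y * B x' y' := by
  have hI := M.isModuleForm_inner
  let G (x y x' y' : E) : A := B x y * M.inner x' y' - M.inner x y * B x' y'
  have hG₁ (x y x' y' : E) (v : A) : G x y x' y' * v * M.inner x' y = 0 := by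
    have h₁ := mul_mul_inner_comm_left hB hMB (M.inner x' y' * v) x x' y
    have h₂ := mul_mul_inner_comm_right hB hMB v x' y' y
    simp only [mul_assoc] at h₁ h₂
    simp only [G, sub_mul, mul_assoc, h₁, h₂, sub_self]
  have hG₂ (x y x' y' x'' : E) (v : A) : G x y x' y' * v * M.inner x'' y = 0 := by
    have hs := mul_mul_star_eq_zero_of_mul_mul_eq_zero (hG₁ x y x' y')
    have h₁ : G x y x' y' * v * M.inner x'' y = -(G x y x'' y' * v * M.inner x' y) := by
      have h₂ := hG₁ x y (x' + x'') y' v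
      have h₃ : G x y (x' + x'') y' = G x y x' y' + G x y x'' y' := by
        simp only [G, hI.add_left, hB.add_left, mul_add]; abel
      rw [h₃, hI.add_left, add_mul, mul_add, add_mul, add_mul, hG₁, hG₁, zero_add, add_zero,
        add_comm] at h₂
      exact eq_neg_of_add_eq_zero_left h₂
    rw [← CStarRing.mul_star_self_eq_zero_iff]
    nth_rewrite 1 [h₁]
    have h₂ := hs (star (M.inner x'' y) * star v)
    simp only [mul_assoc] at h₂
    simp only [star_mul, neg_mul, mul_assoc, h₂, mul_zero, neg_zero]
  have hG₃ (v : A) (x'' y'' : E) : G x y x' y' * v * M.inner x'' y'' = 0 := by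
    have hs := mul_mul_star_eq_zero_of_mul_mul_eq_zero fun v ↦ hG₂ x y x' y' x'' v
    have h₁ : G x y x' y' * v * M.inner x'' y'' = -(G x y'' x' y' * v * M.inner x'' y) := by
      have h₂ := hG₂ x (y + y'') x' y' x'' v
      have h₃ : G x (y + y'') x' y' = G x y x' y' + G x y'' x' y' := by
        simp only [G, hI.add_right, hB.add_right, add_mul]; abel
      rw [h₃, hI.add_right, add_mul, mul_add, add_mul, add_mul, hG₂, hG₂, zero_add, add_zero,
        add_comm] at h₂
      exact eq_neg_of_add_eq_zero_left h₂
    rw [← CStarRing.mul_star_self_eq_zero_iff]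
    nth_rewrite 1 [h₁]
    have h₂ := hs (star (M.inner x'' y'') * star v)
    simp only [mul_assoc] at h₂
    simp only [star_mul, neg_mul, mul_assoc, h₂, mul_zero, neg_zero]
  have hG₄ := eq_zero_of_mul_inner_eq_zero hM (hG₃ (star (G x y x' y')))
  exact sub_eq_zero.mp ((CStarRing.mul_star_self_eq_zero_iff _).mp hG₄)

theorem norm_inner_le (M : CStarNormedInnerProductModule A E) (x y : E) :
    ‖M.inner x y‖ ≤ ‖x‖ * ‖y‖ := by
  have hI := M.isModuleForm_inner
  let _ : CStarModule A E :=
    { inner := fun x y ↦ M.inner y x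
      inner_add_right := M.add_left _ _ _
      inner_self_nonneg := M.inner_self_nonneg _
      inner_self := M.inner_self_eq_zero _
      inner_op_smul_right := M.smulA_left _ _ _
      inner_smul_right_complex := M.smulC_left _ _ _
      star_inner := fun x y ↦ M.star_inner y x
      norm_eq_sqrt_norm_inner_self := fun x ↦ by
        rw [← M.norm_eq, Real.sqrt_sq (norm_nonneg x)] }
  rw [mul_comm]
  exact CStarModule.norm_inner_le E (A := A) (x := y) (y := x)

theorem norm_le_of_mul_inner_self_eq (hM : M.IsFull) {C : ℝ} (hC : 0 ≤ C)
    (hBC : ∀ y, ‖B y y‖ ≤ C * ‖y‖ ^ 2) {a c : A}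
    (hac : ∀ y, c * M.inner y y = a * B y y) : ‖c‖ ≤ C * ‖a‖ := by
  by_contra! hlt
  have hc : 0 < ‖c‖ := (by positivity : 0 ≤ C * ‖a‖).trans_lt hlt
  have hlt' : ‖c‖ * (C * ‖a‖) < ‖star c * c‖ := by
    rw [CStarRing.norm_star_mul_self]; gcongr
  obtain ⟨r, hr₁, hr₂⟩ := exists_between hlt'
  have hr : 0 < r := (by positivity : 0 ≤ ‖c‖ * (C * ‖a‖)).trans_lt hr₁
  have hh : 0 ≤ star c * c := star_mul_self_nonneg c
  have hp : spectralTail (star c * c) r ≠ 0 := fun h ↦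
    hr₂.not_ge (norm_le_of_spectralTail_eq_zero hh hr.le h)
  obtain ⟨x, y, hxy⟩ : ∃ x y, spectralTail (star c * c) r * M.inner x y ≠ 0 := by
    by_contra! h
    exact hp (eq_zero_of_mul_inner_eq_zero hM h)
  set z := spectralTail (star c * c) r • x with hz
  have hz₀ : z ≠ 0 := fun h ↦ hxy <| by
    rw [← M.smulA_left, ← hz, h]
    simpa using M.smulC_left 0 0 y
  have hzz : M.inner z z =
      spectralTailInverse (star c * c) r * (star c * (c * M.inner z z)) := by
    rw [← mul_assoc (star c)]
    nth_rewrite 1 3 [hz]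
    rw [M.smulA_left]
    simp only [← mul_assoc]
    rw [mul_assoc (spectralTailInverse _ r), spectralTailInverse_mul_mul (.of_nonneg hh) hr]
  have hle : ‖z‖ ^ 2 ≤ r⁻¹ * (‖c‖ * (‖a‖ * (C * ‖z‖ ^ 2))) := by
    rw [hac] at hzz
    nth_rewrite 1 [M.norm_eq, hzz]
    refine norm_mul_le_of_le (norm_spectralTailInverse_le hh hr) (norm_mul_le_of_le ?_
      (norm_mul_le_of_le le_rfl (hBC z)))
    rw [norm_star]
  have hz₁ : 0 < ‖z‖ ^ 2 := by positivity
  rw [inv_mul_eq_div, le_div_iff₀ hr] at hle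
  nlinarith

theorem exists_continuousLinearMap_inner (hM : M.IsFull) {C : ℝ} (hC : 0 ≤ C)
    (hBC : ∀ y, ‖B y y‖ ≤ C * ‖y‖ ^ 2)
    (hcomm : ∀ x y x' y', B x y * M.inner x' y' = M.inner x y * B x' y') :
    ∃ g : A →L[ℂ] A, (∀ a b, g a * b = a * g b) ∧ ∀ x y, g (M.inner x y) = B x y := by
  let s : Set (A × A) := {u | ∃ x y, u = (M.inner x y, B x y)}
  let Γ := (Submodule.span ℂ s).topologicalClosure
  have hsΓ (x y : E) : (M.inner x y, B x y) ∈ Γ :=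
    Submodule.le_topologicalClosure _ (Submodule.subset_span ⟨x, y, rfl⟩)
  have hΓ (L : A × A →L[ℂ] A) (hL : ∀ x y, L (M.inner x y, B x y) = 0) {u : A × A} (hu : u ∈ Γ) :
      L u = 0 := by
    refine Submodule.topologicalClosure_minimal (t := L.ker) _ (Submodule.span_le.mpr ?_)
      L.isClosed_ker hu
    rintro _ ⟨x, y, rfl⟩
    exact hL x y
  have hΓ₁ {u : A × A} (hu : u ∈ Γ) (x y : E) : u.2 * M.inner x y = u.1 * B x y := by
    refine sub_eq_zero.mp (hΓ (((ContinuousLinearMap.mul ℂ A).flip (M.inner x y)).comp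
      (.snd ℂ A A) - ((ContinuousLinearMap.mul ℂ A).flip (B x y)).comp (.fst ℂ A A)) ?_ hu)
    intro x' y'
    simp [hcomm]
  have hΓ₂ {u v : A × A} (hu : u ∈ Γ) (hv : v ∈ Γ) : u.2 * v.1 = u.1 * v.2 := by
    refine sub_eq_zero.mp (hΓ ((ContinuousLinearMap.mul ℂ A u.2).comp
      (.fst ℂ A A) - (ContinuousLinearMap.mul ℂ A u.1).comp (.snd ℂ A A)) ?_ hv)
    intro x y
    simp [hΓ₁ hu]
  have hbound {u : A × A} (hu : u ∈ Γ) : ‖u.2‖ ≤ C * ‖u.1‖ :=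
    norm_le_of_mul_inner_self_eq hM hC hBC fun y ↦ hΓ₁ hu y y
  let f : Γ →L[ℂ] A := (ContinuousLinearMap.fst ℂ A A).comp Γ.subtypeL
  have : CompleteSpace Γ := (Submodule.isClosed_topologicalClosure _).completeSpace_coe
  have hf : AntilipschitzWith (max 1 C.toNNReal) f := by
    refine f.antilipschitz_of_bound fun u ↦ ?_
    have h₁ : ‖(u : A × A).1‖ ≤ max 1 C * ‖(u : A × A).1‖ :=
      le_mul_of_one_le_left (norm_nonneg _) (le_max_left _ _)
    have h₂ : ‖(u : A × A).2‖ ≤ max 1 C * ‖(u : A × A).1‖ :=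
      (hbound u.2).trans (by gcongr; exact le_max_right _ _)
    simpa [f, hC, Prod.norm_def] using And.intro h₁ h₂
  have hrange : f.range = ⊤ := by
    refine top_unique (hM ▸ Submodule.topologicalClosure_minimal _ (Submodule.span_le.mpr ?_) ?_)
    · rintro _ ⟨x, y, rfl⟩
      exact ⟨⟨_, hsΓ x y⟩, rfl⟩
    · exact hf.isClosed_range f.uniformContinuous
  let e := ContinuousLinearEquiv.ofBijective f (LinearMap.ker_eq_bot.mpr hf.injective) hrange
  have he (a : A) : ((e.symm a : Γ) : A × A).1 = a := e.apply_symm_apply a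
  refine ⟨((ContinuousLinearMap.snd ℂ A A).comp Γ.subtypeL).comp (e.symm : A →L[ℂ] Γ),
    fun a b ↦ ?_, fun x y ↦ ?_⟩
  · have := hΓ₂ (e.symm a).2 (e.symm b).2
    rwa [he, he] at this
  · have : e.symm (M.inner x y) = ⟨_, hsΓ x y⟩ := (e.symm_apply_eq).mpr rfl
    simp [this]

end CStarNormedInnerProductModule

end HilbertModule

theorem CStarRing.eq_of_forall_mul_left {A : Type*} [NonUnitalNormedRing A] [StarRing A]
    [CStarRing A] {a b : A} (h : ∀ x, x * a = x * b) : a = b := by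
  rw [← sub_eq_zero, ← CStarRing.star_mul_self_eq_zero_iff, mul_sub, h, sub_self]

theorem CStarRing.eq_of_forall_mul_right {A : Type*} [NonUnitalNormedRing A] [StarRing A]
    [CStarRing A] {a b : A} (h : ∀ x, a * x = b * x) : a = b := by
  rw [← sub_eq_zero, ← CStarRing.mul_star_self_eq_zero_iff, sub_mul, h, sub_self]

theorem DoubleCentralizer.mk_mem_center {A : Type*} [NonUnitalCStarAlgebra A] (g : A →L[ℂ] A)
    (hg : ∀ a b, g a * b = a * g b) : (⟨(g, g), hg⟩ : 𝓜(ℂ, A)) ∈ Set.center 𝓜(ℂ, A) := by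
  have hg₁ (a b : A) : g (a * b) = a * g b :=
    CStarRing.eq_of_forall_mul_right fun z ↦ by rw [hg, mul_assoc, mul_assoc, hg]
  refine Semigroup.mem_center_iff.mpr fun m ↦ DoubleCentralizer.ext ℂ A _ _ (Prod.ext ?_ ?_)
  · ext a
    refine CStarRing.eq_of_forall_mul_left fun x ↦ ?_
    change x * m.fst (g a) = x * g (m.fst a)
    rw [← m.central, ← hg₁, m.central, hg₁]
  · ext a
    refine CStarRing.eq_of_forall_mul_right fun x ↦ ?_
    change g (m.snd a) * x = m.snd (g a) * x
    rw [hg, ← hg₁, m.central, hg₁, m.central, hg]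

/-- **Theorem 4.1**: if `T, S` are nonzero bounded `A`-linear maps between full Hilbert
`A`-modules such that `⟪x, y⟫ = 0` implies `⟪T x, S y⟫ = 0`, then there is a central
multiplier `γ ∈ Z(M(A))` with `⟪T x, S y⟫ = γ · ⟪x, y⟫` for all `x, y` (where `γ` acts on
`A ⊴ M(A)` via `γ.fst`). -/
theorem full_orthogonality_preserving_pair_central_multiplier
    {A E F : Type*} [NonUnitalCStarAlgebra A] [PartialOrder A] [StarOrderedRing A]
    [NormedAddCommGroup E] [Module ℂ E] [SMul A E] [CompleteSpace E]
    [NormedAddCommGroup F] [Module ℂ F] [SMul A F] [CompleteSpace F]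
    (ME : CStarNormedInnerProductModule A E) (MF : CStarNormedInnerProductModule A F)
    (hEfull : ME.IsFull) (hFfull : MF.IsFull)
    (T S : E → F) (hT : T ≠ 0) (hS : S ≠ 0)
    (hTadd : ∀ x y : E, T (x + y) = T x + T y)
    (hTsmulC : ∀ (c : ℂ) (x : E), T (c • x) = c • T x)
    (hTsmulA : ∀ (a : A) (x : E), T (a • x) = a • T x)
    (hTbdd : ∃ C : ℝ, ∀ x : E, ‖T x‖ ≤ C * ‖x‖)
    (hSadd : ∀ x y : E, S (x + y) = S x + S y)
    (hSsmulC : ∀ (c : ℂ) (x : E), S (c • x) = c • S x)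
    (hSsmulA : ∀ (a : A) (x : E), S (a • x) = a • S x)
    (hSbdd : ∃ C : ℝ, ∀ x : E, ‖S x‖ ≤ C * ‖x‖)
    (hTS : ∀ x y : E, ME.inner x y = 0 → MF.inner (T x) (S y) = 0) :
    ∃ γ : 𝓜(ℂ, A), γ ∈ Set.center 𝓜(ℂ, A) ∧
      ∀ x y : E, MF.inner (T x) (S y) = γ.fst (ME.inner x y) := by
  have hF := MF.isModuleForm_inner
  have hB : IsModuleForm fun x y ↦ MF.inner (T x) (S y) :=
    { add_left := fun x y z ↦ by rw [hTadd, hF.add_left]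
      add_right := fun x y z ↦ by rw [hSadd, hF.add_right]
      smulC_left := fun c x y ↦ by rw [hTsmulC, hF.smulC_left]
      smulC_right := fun c x y ↦ by rw [hSsmulC, hF.smulC_right]
      smulA_left := fun a x y ↦ by rw [hTsmulA, hF.smulA_left]
      smulA_right := fun a x y ↦ by rw [hSsmulA, hF.smulA_right] }
  obtain ⟨C, hC⟩ := hTbdd
  obtain ⟨D, hD⟩ := hSbdd
  have hbound (y : E) : ‖MF.inner (T y) (S y)‖ ≤ |C| * |D| * ‖y‖ ^ 2 :=
    calc ‖MF.inner (T y) (S y)‖ ≤ ‖T y‖ * ‖S y‖ := MF.norm_inner_le _ _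
      _ ≤ (|C| * ‖y‖) * (|D| * ‖y‖) := by
        gcongr
        · exact (hC y).trans (by gcongr; exact le_abs_self C)
        · exact (hD y).trans (by gcongr; exact le_abs_self D)
      _ = |C| * |D| * ‖y‖ ^ 2 := by ring
  obtain ⟨g, hg, hgB⟩ := CStarNormedInnerProductModule.exists_continuousLinearMap_inner hEfull
    (by positivity) hbound (CStarNormedInnerProductModule.mul_inner_comm hEfull hB hTS)
  exact ⟨⟨(g, g), hg⟩, DoubleCentralizer.mk_mem_center g hg, fun x y ↦ (hgB x y).symm⟩
end
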